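/- arXiv:2101.08337 — 2 statements merged into one kernel-verified Lean document; each statement's English description precedes it below -/
import Mathlib

section
/- Let (R, m) be a Henselian local domain and let A be an integral domain that is an integral ring extension of R. Then A is a Henselian local ring. -/
open Polynomial IsLocalRing

/-- Over a Henselian local ring, every point of an étale algebra that is rational over the residue
field lifts to a section. -/
theorem HenselianLocalRing.exists_algHom_of_etale {R S : Type*} [CommRing R]
    [HenselianLocalRing R] [CommRing S] [Algebra R S] [Algebra.Etale R S]
    (φ : S →ₐ[R] ResidueField R) :
    ∃ ψ : S →ₐ[R] R, (IsScalarTower.toAlgHom R R (ResidueField R)).comp ψ = φ := by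
  let Q := RingHom.ker φ.toRingHom
  have : Q.IsPrime := RingHom.ker_isPrime _
  obtain ⟨s, hsQ, hs⟩ := Algebra.IsEtaleAt.exists_isStandardEtale (R := R) Q
  let P : StandardEtalePresentation R (Localization.Away s) := Nonempty.some inferInstance
  have hφs : IsUnit (φ s) := isUnit_iff_ne_zero.mpr hsQ
  let φ' : Localization.Away s →ₐ[R] ResidueField R :=
    IsLocalization.Away.liftAlgHom (f := φ) s hφs
  have hφ' : φ'.comp (IsScalarTower.toAlgHom R S (Localization.Away s)) = φ := by
    ext x
    simp [φ']
  have hx := P.hasMap.map φ'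
  obtain ⟨a, ha, hax⟩ := ((HenselianLocalRing.TFAE R).out 0 1 rfl rfl).mp ‹_› P.f P.monic_f
    (φ' P.x) hx.1 hx.isUnit_derivative_f.ne_zero
  have ha' : P.HasMap a := by
    refine ⟨by simpa [aeval_def] using ha, ?_⟩
    rw [← isUnit_map_iff (residue R)]
    have h := hx.2
    rw [← hax] at h
    simpa [aeval_def, eval₂_at_apply, ← ResidueField.algebraMap_eq] using h
  let ψ' : Localization.Away s →ₐ[R] R := (P.lift a ha').comp P.equivRing.toAlgHom
  refine ⟨ψ'.comp (IsScalarTower.toAlgHom R S (Localization.Away s)), ?_⟩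
  rw [← hφ', ← AlgHom.comp_assoc]
  congr 1
  apply P.hom_ext
  simpa [ψ', StandardEtalePair.lift_X] using hax

/-- Hensel's lemma for factorizations: coprime monic factorizations over the residue field
lift to monic factorizations. -/
theorem HenselianLocalRing.exists_monic_mul_eq {R : Type*} [CommRing R] [HenselianLocalRing R]
    {p : R[X]} (hp : p.Monic) {f g : (ResidueField R)[X]} (hf : f.Monic) (hg : g.Monic)
    (hfg : p.map (residue R) = f * g) (hcop : IsCoprime f g) :
    ∃ F G : R[X], F.Monic ∧ G.Monic ∧ p = F * G ∧
      F.natDegree = f.natDegree ∧ G.natDegree = g.natDegree := by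
  have hn : p.natDegree = f.natDegree + g.natDegree := by
    rw [← hf.natDegree_mul hg, ← hfg, hp.natDegree_map]
  let φ : UniversalCoprimeFactorizationRing f.natDegree g.natDegree hn (.mk p hp rfl) →ₐ[R]
      ResidueField R :=
    (UniversalCoprimeFactorizationRing.homEquiv _ _ _ hn _).symm
      ⟨(.mk f hf rfl, .mk g hg rfl), hfg.symm, hcop⟩
  obtain ⟨ψ, -⟩ := HenselianLocalRing.exists_algHom_of_etale φ
  let q := UniversalCoprimeFactorizationRing.homEquiv _ _ _ hn _ ψ
  refine ⟨q.1.1.1, q.1.2.1, q.1.1.monic, q.1.2.monic, ?_, q.1.1.natDegree, q.1.2.natDegree⟩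
  simpa using q.2.1.symm

/-- A domain integral over a Henselian local ring is local. -/
theorem HenselianLocalRing.isLocalRing_of_isIntegral (R : Type*) {A : Type*} [CommRing R]
    [HenselianLocalRing R] [CommRing A] [IsDomain A] [Algebra R A] [Algebra.IsIntegral R A] :
    IsLocalRing A := by
  refine .of_isUnit_or_isUnit_one_sub_self fun b ↦ ?_
  classical
  have hex : ∃ n, ∃ p : R[X], p.Monic ∧ aeval b p = 0 ∧ p.natDegree = n := by
    obtain ⟨p, hp, hpb⟩ := Algebra.IsIntegral.isIntegral (R := R) b
    exact ⟨_, p, hp, hpb, rfl⟩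
  obtain ⟨p, hp, hpb, hpn⟩ := Nat.find_spec hex
  have hmin (q : R[X]) (hq : q.Monic) (hqb : aeval b q = 0) : p.natDegree ≤ q.natDegree :=
    hpn ▸ Nat.find_min' hex ⟨q, hq, hqb, rfl⟩
  have hpbar : (p.map (residue R)).Monic := hp.map _
  obtain ⟨h, hph, hXh⟩ :=
    (p.map (residue R)).exists_eq_pow_rootMultiplicity_mul_and_not_dvd hpbar.ne_zero 0
  set k := (p.map (residue R)).rootMultiplicity 0
  rw [C_0, sub_zero] at hph hXh
  have hh : h.Monic := (monic_X_pow k).of_mul_monic_left (hph ▸ hpbar)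
  obtain ⟨F, G, hF, hG, hFG, hFd, hGd⟩ := HenselianLocalRing.exists_monic_mul_eq hp
    (monic_X_pow k) hh hph ((irreducible_X.coprime_iff_not_dvd.mpr hXh).pow_left)
  have hdeg : p.natDegree = F.natDegree + G.natDegree := by rw [hFG, hF.natDegree_mul hG]
  have hroot (x : R) (hx : IsUnit (p.eval x)) : IsUnit (b - algebraMap R A x) := by
    have h : (b - algebraMap R A x) ∣ aeval b p - aeval (algebraMap R A x) p := by
      simpa only [eval_map_algebraMap] using
        sub_dvd_eval_sub b (algebraMap R A x) (p.map (algebraMap R A))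
    rw [hpb, zero_sub, dvd_neg, aeval_algebraMap_apply_eq_algebraMap_eval] at h
    exact isUnit_of_dvd_unit h (hx.map _)
  have hres (x : R) (hx : (p.map (residue R)).eval (residue R x) ≠ 0) : IsUnit (p.eval x) := by
    rw [← isUnit_map_iff (residue R), isUnit_iff_ne_zero]
    simpa [eval_map, eval₂_at_apply] using hx
  rw [hFG, map_mul, mul_eq_zero] at hpb
  rcases hpb with hb | hb
  · right
    have hh1 : h = 1 := by
      rw [← hh.natDegree_eq_zero]
      have := hmin F hF hb
      lia
    rw [← neg_sub, IsUnit.neg_iff, ← map_one (algebraMap R A)]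
    refine hroot 1 (hres 1 ?_)
    simp [hph, hh1]
  · left
    have hk : k = 0 := by
      have := hmin G hG hb
      rw [natDegree_X_pow] at hFd
      lia
    have := hroot 0 (hres 0 ?_)
    · simpa using this
    · rw [hph, hk, pow_zero, one_mul, map_zero]
      rwa [X_dvd_iff, coeff_zero_eq_eval_zero] at hXh

/-- A root `r` of a polynomial over a local ring `A` with unit linear coefficient is rational as
soon as it is a nonunit in the local ring `A[r]`, finite over `A`. -/
theorem Polynomial.mem_range_algebraMap_of_isLocalRing_adjoin {A B : Type*} [CommRing A]
    [IsLocalRing A] [CommRing B] [Algebra A B] {r : B} (hr : IsIntegral A r)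
    [IsLocalRing (Algebra.adjoin A {r})] (hru : ¬ IsUnit r) {f : A[X]} (hf : aeval r f = 0)
    (h₀ : f.coeff 0 ∈ maximalIdeal A) (h₁ : IsUnit (f.coeff 1)) :
    r ∈ Set.range (algebraMap A B) := by
  let D := Algebra.adjoin A {r}
  let s : D := ⟨r, Algebra.self_mem_adjoin_singleton A r⟩
  have : Module.Finite A D := Algebra.finite_adjoin_simple_of_isIntegral hr
  have hs : s ∈ maximalIdeal D := fun h ↦ hru (h.map D.val)
  have hfs : aeval s f = 0 := Subtype.val_injective (by
    rw [← Subalgebra.coe_val, ← aeval_algHom_apply]; simpa [s] using hf)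
  have hu : IsUnit (aeval s f.divX) := by
    rw [← f.divX.divX_mul_X_add]
    simp only [map_add, map_mul, aeval_X, aeval_C, coeff_divX, zero_add]
    by_contra h
    have h' : algebraMap A D (f.coeff 1) ∈ maximalIdeal D := by
      rw [← Ideal.add_mem_iff_right _ (Ideal.mul_mem_left _ (aeval s f.divX.divX) hs)]
      exact h
    exact h' (h₁.map _)
  have hs' : s ∈ (maximalIdeal A).map (algebraMap A D) := by
    rw [← f.divX_mul_X_add] at hfs
    simp only [map_add, map_mul, aeval_X, aeval_C] at hfs
    rw [← Ideal.unit_mul_mem_iff_mem _ hu, eq_neg_of_add_eq_zero_left hfs]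
    exact neg_mem (Ideal.mem_map_of_mem _ h₀)
  have htop : (⊤ : Submodule A D) ≤ LinearMap.range (Algebra.linearMap A D) := by
    refine Submodule.le_of_le_smul_of_le_jacobson_bot Module.Finite.fg_top
      (maximalIdeal_le_jacobson _) ?_
    rw [Ideal.smul_top_eq_map]
    rintro ⟨x, hx⟩ -
    obtain ⟨q, rfl⟩ := Algebra.adjoin_mem_exists_aeval A r hx
    have hq : (⟨aeval r q, hx⟩ : D) = aeval s q := Subtype.val_injective (by
      rw [← Subalgebra.coe_val, ← aeval_algHom_apply]; simp [s])
    rw [hq, ← q.divX_mul_X_add]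
    simp only [map_add, map_mul, aeval_X, aeval_C]
    rw [add_comm]
    exact Submodule.add_mem_sup ⟨_, rfl⟩ (Ideal.mul_mem_left _ _ hs')
  obtain ⟨a, ha⟩ := htop (Submodule.mem_top : s ∈ ⊤)
  exact ⟨a, congrArg Subtype.val ha⟩

/-- A monic polynomial over a domain `A` whose constant coefficient is a nonunit has a nonunit root
in the integral closure of `A` in an algebraically closed extension. -/
theorem Polynomial.Monic.exists_not_isUnit_aeval_eq_zero {A L : Type*} [CommRing A] [Field L]
    [IsAlgClosed L] [Algebra A L] [FaithfulSMul A L] {f : A[X]} (hf : f.Monic)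
    (h₀ : ¬ IsUnit (f.coeff 0)) :
    ∃ r : integralClosure A L, ¬ IsUnit r ∧ aeval r f = 0 := by
  by_contra! H
  let B := integralClosure A L
  have : FaithfulSMul A B := .tower_bot A B L
  have key : ∃ u : B, IsUnit u ∧ (u : L) = (f.map (algebraMap A L)).roots.prod := by
    refine Multiset.prod_induction (fun x : L ↦ ∃ u : B, IsUnit u ∧ (u : L) = x) _ ?_
      ⟨1, isUnit_one, rfl⟩ ?_
    · rintro _ _ ⟨u, hu, rfl⟩ ⟨v, hv, rfl⟩
      exact ⟨u * v, hu.mul hv, rfl⟩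
    · intro x hx
      have hx' : aeval x f = 0 := by
        simpa only [IsRoot, eval_map_algebraMap] using (mem_roots'.mp hx).2
      refine ⟨⟨x, f, hf, hx'⟩, ?_, rfl⟩
      by_contra h
      refine H _ h (Subtype.val_injective ?_)
      rw [← Subalgebra.coe_val, ← aeval_algHom_apply]
      simpa using hx'
  obtain ⟨u, hu, hur⟩ := key
  have hc : algebraMap A B (f.coeff 0) = (-1) ^ f.natDegree * u := by
    apply Subtype.val_injective
    have := (IsAlgClosed.splits (f.map (algebraMap A L))).coeff_zero_eq_prod_roots_of_monic
      (hf.map _)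
    rw [coeff_map, hf.natDegree_map, ← hur] at this
    simpa using this
  have hloc : IsLocalHom (algebraMap A B) :=
    (algebraMap_isIntegral_iff.mpr inferInstance).isLocalHom (FaithfulSMul.algebraMap_injective A B)
  exact h₀ (hloc.map_nonunit _ (hc ▸ ((isUnit_one.neg.pow _).mul hu)))

/-- Let `R` be a Henselian local domain and let `A` be an integral domain that
is an integral ring extension of `R`. Then `A` is a Henselian local ring. -/
theorem henselianLocalRing_of_integral_extension_domain
    {R A : Type u} [CommRing R] [IsDomain R] [HenselianLocalRing R]
    [CommRing A] [IsDomain A] [Algebra R A]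
    (hinj : Function.Injective (algebraMap R A))
    (hint : Algebra.IsIntegral R A) :
    HenselianLocalRing A := by
  have : IsLocalRing A := HenselianLocalRing.isLocalRing_of_isIntegral R
  refine ⟨fun f hf a₀ h₀ h₁ ↦ ?_⟩
  let L := AlgebraicClosure (FractionRing A)
  let B := integralClosure A L
  have : FaithfulSMul A L := .trans A (FractionRing A) L
  have : FaithfulSMul A B := .tower_bot A B L
  let g := taylor a₀ f
  have hg : g.Monic := hf.comp_X_add_C a₀
  have hg₀ : g.coeff 0 ∈ maximalIdeal A := by rwa [taylor_coeff_zero]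
  have hg₁ : IsUnit (g.coeff 1) := by rwa [taylor_coeff_one]
  obtain ⟨r, hru, hr⟩ := hg.exists_not_isUnit_aeval_eq_zero (L := L) hg₀
  let D := Algebra.adjoin A {r}
  have : Module.Finite A D :=
    Algebra.finite_adjoin_simple_of_isIntegral (Algebra.IsIntegral.isIntegral r)
  have : Algebra.IsIntegral R D := Algebra.IsIntegral.trans A
  have : IsLocalRing D := HenselianLocalRing.isLocalRing_of_isIntegral R
  obtain ⟨a, rfl⟩ := mem_range_algebraMap_of_isLocalRing_adjoin
    (Algebra.IsIntegral.isIntegral r) hru hr hg₀ hg₁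
  rw [aeval_algebraMap_apply_eq_algebraMap_eval,
    FaithfulSMul.algebraMap_eq_zero_iff, taylor_eval] at hr
  refine ⟨a + a₀, hr, ?_⟩
  rw [add_sub_cancel_right]
  exact fun h ↦ hru (h.map _)
end

section
/- Let V be a valuation ring of a field K (i.e., V is a valuation ring with fraction field K). Then V is a Henselian local ring if and only if for every algebraic field extension L of K, the integral closure A of V in L is a valuation ring of L, and A is the unique valuation ring of L that dominates V. -/
/-- A valuation subring `W` of `L` *dominates* a valuation subring `V` of `K` (along
`K → L`): `V ⊆ W` and the maximal ideal of `W` contracts to the maximal ideal of `V`,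
expressed via nonunits. -/
def ValuationSubring.Dominates {K L : Type u} [Field K] [Field L] [Algebra K L]
    (W : ValuationSubring L) (V : ValuationSubring K) : Prop :=
  ∃ h : ∀ x : K, x ∈ V → algebraMap K L x ∈ W,
    ∀ (x : K) (hx : x ∈ V),
      (¬IsUnit (⟨x, hx⟩ : V) ↔ ¬IsUnit (⟨algebraMap K L x, h x hx⟩ : W))

section

open Polynomial IsLocalRing

theorem HenselianLocalRing.exists_algHom_of_isStandardEtale {R T : Type*} [CommRing R]
    [HenselianLocalRing R] [CommRing T] [Algebra R T] [Algebra.IsStandardEtale R T]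
    (φ : T →ₐ[R] ResidueField R) : Nonempty (T →ₐ[R] R) := by
  obtain ⟨P⟩ := Algebra.IsStandardEtale.nonempty_standardEtalePresentation (R := R) (S := T)
  have hx := P.hasMap.map φ
  have hR := ((HenselianLocalRing.TFAE R).out 0 1 rfl rfl).mp ‹_›
  obtain ⟨a, ha, hax⟩ := hR P.f P.monic_f (φ P.x)
    hx.1 hx.isUnit_derivative_f.ne_zero
  have hga : IsUnit (aeval a P.g) := by
    refine (isUnit_map_iff (residue R) _).mp ?_
    have := hx.2
    rw [← hax] at this
    rwa [← ResidueField.algebraMap_eq, aeval_algebraMap_apply] at this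
  exact ⟨(P.lift a ⟨ha, hga⟩).comp P.equivRing.toAlgHom⟩

theorem HenselianLocalRing.exists_monic_mul_eq_of_isCoprime {R : Type*} [CommRing R]
    [HenselianLocalRing R] {p : R[X]} (hp : p.Monic)
    {f g : (maximalIdeal R).ResidueField[X]} (hf : f.Monic) (hg : g.Monic)
    (H : p.map (algebraMap R _) = f * g) (hfg : IsCoprime f g) :
    ∃ f' g' : R[X], f'.Monic ∧ g'.Monic ∧ p = f' * g' ∧
      f'.natDegree = f.natDegree ∧ g'.natDegree = g.natDegree := by
  obtain ⟨R', _, _, _, Q, _, _, f', g', hb, hf', hg', hp', -, hff, hgg⟩ :=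
    Algebra.exists_etale_bijective_residueFieldMap_and_map_eq_mul_and_isCoprime
      (maximalIdeal R) p f g hp hf hg H hfg
  obtain ⟨s, hsQ, hs⟩ := Algebra.IsEtaleAt.exists_isStandardEtale (R := R) Q
  let e := AlgEquiv.ofBijective _ hb
  let e' : ResidueField R ≃ₐ[R] (maximalIdeal R).ResidueField :=
    .ofBijective (IsScalarTower.toAlgHom R (R ⧸ maximalIdeal R) _)
      (Ideal.bijective_algebraMap_quotient_residueField _)
  let ψ : R' →ₐ[R] Q.ResidueField := IsScalarTower.toAlgHom R R' Q.ResidueField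
  have hψ : IsUnit (ψ s) := by
    simpa [ψ] using hsQ
  let φ : Localization.Away s →ₐ[R] Q.ResidueField := IsLocalization.Away.liftAlgHom s hψ
  obtain ⟨χ⟩ := exists_algHom_of_isStandardEtale
    ((e'.symm.toAlgHom.comp e.symm.toAlgHom).comp φ)
  let θ : R' →ₐ[R] R := χ.comp (IsScalarTower.toAlgHom R R' (Localization.Away s))
  have hdeg {q : R'[X]} {r : (maximalIdeal R).ResidueField[X]} (hq : q.Monic)
      (h : r.map (Ideal.ResidueField.mapₐ (maximalIdeal R) Q (Algebra.ofId _ _)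
        (Ideal.over_def Q _)).toRingHom = q.map (algebraMap _ _)) :
      (q.map θ.toRingHom).natDegree = r.natDegree := by
    rw [hq.natDegree_map, ← hq.natDegree_map (algebraMap R' Q.ResidueField), ← h,
      natDegree_map]
  refine ⟨f'.map θ.toRingHom, g'.map θ.toRingHom, hf'.map _, hg'.map _, ?_, hdeg hf' hff,
    hdeg hg' hgg⟩
  rw [← Polynomial.map_mul, ← hp', Polynomial.map_map]
  simp

theorem IsLocalRing.of_isIntegral_of_henselianLocalRing (R : Type*) {S : Type*} [CommRing R]
    [HenselianLocalRing R] [IsDomain R] [CommRing S] [IsDomain S] [Algebra R S]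
    [Algebra.IsIntegral R S] : IsLocalRing S := by
  refine .of_isUnit_or_isUnit_one_sub_self fun e ↦ ?_
  by_contra! he
  have hint : IsIntegral R e := Algebra.IsIntegral.isIntegral e
  set p := minpoly R e with hp
  have hpm : p.Monic := minpoly.monic hint
  let κ := (maximalIdeal R).ResidueField
  have hroot (a : R) (ha : ¬ IsUnit (algebraMap R S a - e)) :
      (p.map (algebraMap R κ)).IsRoot (algebraMap R κ a) := by
    rw [IsRoot.def, eval_map_algebraMap, aeval_algebraMap_apply_eq_algebraMap_eval,
      Ideal.algebraMap_residueField_eq_zero, mem_maximalIdeal]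
    refine fun hu ↦ ha (isUnit_of_dvd_unit ?_ (hu.map (algebraMap R S)))
    have := sub_dvd_eval_sub (algebraMap R S a) e (p.map (algebraMap R S))
    simpa [eval_map_algebraMap, hp, aeval_algebraMap_apply_eq_algebraMap_eval] using this
  have h0 := hroot 0 (by simpa using he.1)
  have h1 := hroot 1 (by simpa using he.2)
  have hpm' := hpm.map (algebraMap R κ)
  obtain ⟨q, hq, hq'⟩ := exists_eq_pow_rootMultiplicity_mul_and_not_dvd _ hpm'.ne_zero (0 : κ)
  simp only [map_zero, sub_zero, map_one] at h0 h1 hq hq'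
  have hn : (p.map (algebraMap R κ)).rootMultiplicity 0 ≠ 0 :=
    ((rootMultiplicity_pos hpm'.ne_zero).mpr h0).ne'
  generalize (p.map (algebraMap R κ)).rootMultiplicity 0 = n at hq hn
  have hqm : q.Monic := (monic_X_pow n).of_mul_monic_left (hq ▸ hpm')
  have hq1 : q.IsRoot 1 := by simpa [hq] using h1
  have hcop : IsCoprime (X ^ n) q :=
    ((irreducible_X.coprime_iff_not_dvd).mpr hq').pow_left
  obtain ⟨f, g, hf, hg, hfg, hdf, hdg⟩ :=
    HenselianLocalRing.exists_monic_mul_eq_of_isCoprime hpm (monic_X_pow n) hqm hq hcop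
  rcases (minpoly.irreducible hint).isUnit_or_isUnit (hp.symm.trans hfg) with hu | hu
  · rw [natDegree_X_pow, (hf.isUnit_iff).mp hu, natDegree_one] at hdf
    exact hn hdf.symm
  · rw [(hg.isUnit_iff).mp hu, natDegree_one] at hdg
    rw [hqm.natDegree_eq_zero.mp hdg.symm] at hq1
    simp at hq1

theorem IsLocalRing.exists_algebraMap_eq_or_eq_inv_of_aeval_eq_zero {A L : Type*} [CommRing A]
    [IsLocalRing A] [Field L] [Algebra A L] [IsIntegrallyClosedIn A L] {x : L} {p : A[X]}
    (hx : aeval x p = 0) (hp : ∃ i, IsUnit (p.coeff i)) :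
    ∃ y : A, algebraMap A L y = x ∨ algebraMap A L y = x⁻¹ := by
  obtain ⟨n, hn⟩ : ∃ n, p.natDegree ≤ n := ⟨_, le_rfl⟩
  induction n generalizing p with
  | zero =>
    obtain ⟨i, hi⟩ := hp
    rw [eq_C_of_natDegree_le_zero hn] at hx hi
    rw [coeff_C] at hi
    split_ifs at hi
    · exact ((hi.map (algebraMap A L)).ne_zero (by simpa using hx)).elim
    · exact (not_isUnit_zero hi).elim
  | succ n ih =>
    set a := p.coeff (n + 1) with ha
    have hax : IsIntegral A (a • x) := by
      rcases hn.lt_or_eq with h | h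
      · simp [ha, coeff_eq_zero_of_natDegree_lt h, isIntegral_zero]
      · rw [ha, ← h]
        exact isIntegral_leadingCoeff_smul p x hx
    obtain ⟨b, hb⟩ := IsIntegrallyClosedIn.isIntegral_iff.mp hax
    rw [Algebra.smul_def] at hb
    by_cases hau : IsUnit a
    · obtain ⟨c, hc⟩ := hau.exists_left_inv
      exact ⟨c * b, .inl (by rw [map_mul, hb, ← mul_assoc, ← map_mul, hc, map_one, one_mul])⟩
    by_cases hbu : IsUnit b
    · obtain ⟨c, hc⟩ := hbu.exists_left_inv
      refine ⟨c * a, .inr (eq_inv_of_mul_eq_one_left ?_)⟩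
      rw [map_mul, mul_assoc, ← hb, ← map_mul, hc, map_one]
    obtain ⟨i, hi⟩ := hp
    refine ih (p := p - C a * X ^ (n + 1) + C b * X ^ n) ?_ ⟨i, ?_⟩ ?_
    · simp only [map_add, map_sub, hx, map_mul, aeval_C, map_pow, aeval_X, hb]
      ring
    · simp only [coeff_add, coeff_sub, coeff_C_mul_X_pow]
      have : i ≠ n + 1 := by rintro rfl; exact hau hi
      rw [if_neg this, sub_zero]
      split_ifs
      · by_contra h
        have := (maximalIdeal A).sub_mem h hbu
        rw [add_sub_cancel_right] at this
        exact this hi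
      · simpa using hi
    · refine natDegree_le_iff_coeff_eq_zero.mpr fun j hj ↦ ?_
      simp only [coeff_add, coeff_sub, coeff_C_mul_X_pow, if_neg hj.ne', add_zero]
      split_ifs with h
      · simp [h, ha]
      · rw [sub_zero, coeff_eq_zero_of_natDegree_lt (by omega)]

theorem ValuationSubring.exists_aeval_eq_zero_and_coeff_eq_one {K L : Type*} [Field K] [Field L]
    [Algebra K L] [Algebra.IsAlgebraic K L] (V : ValuationSubring K) (x : L) :
    ∃ p : V[X], aeval x p = 0 ∧ ∃ i, p.coeff i = 1 := by
  set q := minpoly K x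
  have hq : q ≠ 0 := minpoly.ne_zero (Algebra.IsIntegral.isIntegral x)
  obtain ⟨i, hi, hmax⟩ := Finset.exists_max_image q.support (fun j ↦ V.valuation (q.coeff j))
    (nonempty_support_iff.mpr hq)
  rw [mem_support_iff] at hi
  have hmem (j : ℕ) : (q.coeff i)⁻¹ * q.coeff j ∈ V := by
    rw [← V.valuation_le_one_iff, map_mul, map_inv₀]
    refine inv_mul_le_one_of_le₀ ?_ zero_le
    by_cases hj : j ∈ q.support
    · exact hmax j hj
    · simp [notMem_support_iff.mp hj]
  obtain ⟨p, hp⟩ := (lifts_iff_coeff_lifts (f := algebraMap V K) (C (q.coeff i)⁻¹ * q)).mpr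
    fun j ↦ ⟨(⟨_, hmem j⟩ : V), by rw [coeff_C_mul]; rfl⟩
  replace hp : p.map (algebraMap V K) = C (q.coeff i)⁻¹ * q := hp
  refine ⟨p, ?_, i, ?_⟩
  · rw [← aeval_map_algebraMap K, hp, map_mul, minpoly.aeval, mul_zero]
  · apply IsFractionRing.injective V K
    rw [← coeff_map, hp, coeff_C_mul, inv_mul_cancel₀ hi, map_one]

namespace ValuationSubring

variable {K L : Type u} [Field K] [Field L] [Algebra K L] {V : ValuationSubring K}

theorem dominates_iff {W : ValuationSubring L} :
    W.Dominates V ↔ ∀ x ∈ V, algebraMap K L x ∈ W ∧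
      (algebraMap K L x ∈ W.nonunits ↔ x ∈ V.nonunits) := by
  have key (h : ∀ x ∈ V, algebraMap K L x ∈ W) (x : K) (hx : x ∈ V) :
      (¬IsUnit (⟨x, hx⟩ : V) ↔ ¬IsUnit (⟨algebraMap K L x, h x hx⟩ : W)) ↔
        (algebraMap K L x ∈ W.nonunits ↔ x ∈ V.nonunits) := by
    rw [← _root_.mem_nonunits_iff, ← _root_.mem_nonunits_iff, ← mem_maximalIdeal, ← mem_maximalIdeal,
      ← coe_mem_nonunits_iff, ← coe_mem_nonunits_iff]
    exact iff_comm
  constructor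
  · rintro ⟨h, h'⟩ x hx
    exact ⟨h x hx, (key h x hx).mp (h' x hx)⟩
  · intro h
    exact ⟨fun x hx ↦ (h x hx).1, fun x hx ↦ (key (fun x hx ↦ (h x hx).1) x hx).mpr (h x hx).2⟩

namespace Dominates

variable {W : ValuationSubring L}

theorem algebraMap_mem (h : W.Dominates V) {x : K} (hx : x ∈ V) : algebraMap K L x ∈ W :=
  h.1 x hx

theorem algebraMap_mem_nonunits_iff (h : W.Dominates V) {x : K} (hx : x ∈ V) :
    algebraMap K L x ∈ W.nonunits ↔ x ∈ V.nonunits :=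
  (dominates_iff.mp h x hx).2

theorem mem_of_isIntegral (h : W.Dominates V) {x : L} (hx : IsIntegral V x) : x ∈ W := by
  obtain ⟨p, hp, hpx⟩ := hx
  let f : V →+* W :=
    ((algebraMap K L).comp (algebraMap V K)).codRestrict W fun y ↦ h.algebraMap_mem y.2
  have : IsIntegral W x := by
    refine ⟨p.map f, hp.map f, ?_⟩
    rw [eval₂_map]
    exact hpx
  obtain ⟨y, hy⟩ := IsIntegrallyClosed.isIntegral_iff.mp this
  exact hy ▸ y.2

theorem coe_mem_nonunits_of_mem_maximalIdeal [IsLocalRing (integralClosure V L)]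
    (h : W.Dominates V) {x : integralClosure V L} (hx : x ∈ maximalIdeal (integralClosure V L)) :
    (x : L) ∈ W.nonunits := by
  let ι : integralClosure V L →+* W :=
    (algebraMap (integralClosure V L) L).codRestrict W fun y ↦ h.mem_of_isIntegral y.2
  have hc : ((maximalIdeal W).comap ι).comap (algebraMap V (integralClosure V L)) =
      maximalIdeal V := by
    ext y
    rw [Ideal.mem_comap, Ideal.mem_comap, ← coe_mem_nonunits_iff, ← coe_mem_nonunits_iff]
    exact h.algebraMap_mem_nonunits_iff y.2
  have hm : ((maximalIdeal W).comap ι).IsMaximal :=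
    Ideal.isMaximal_of_isIntegral_of_isMaximal_comap (R := V) _ (hc ▸ inferInstance)
  rw [← eq_maximalIdeal hm, Ideal.mem_comap, ← coe_mem_nonunits_iff] at hx
  exact hx

end Dominates

theorem isIntegral_algebraMap_iff_mem {x : K} : IsIntegral V (algebraMap K L x) ↔ x ∈ V := by
  rw [isIntegral_algebraMap_iff (algebraMap K L).injective, IsIntegrallyClosed.isIntegral_iff]
  exact ⟨fun ⟨y, hy⟩ ↦ hy ▸ y.2, fun hx ↦ ⟨⟨x, hx⟩, rfl⟩⟩

variable (V L) in
theorem exists_coe_eq_integralClosure [HenselianLocalRing V] [Algebra.IsAlgebraic K L] :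
    ∃ W : ValuationSubring L, (W : Set L) = {x | IsIntegral V x} ∧ W.Dominates V ∧
      ∀ W' : ValuationSubring L, W'.Dominates V → W' = W := by
  have : IsLocalRing (integralClosure V L) := .of_isIntegral_of_henselianLocalRing V
  have hor (x : L) : x ∈ integralClosure V L ∨ x⁻¹ ∈ integralClosure V L := by
    obtain ⟨p, hp, i, hi⟩ := V.exists_aeval_eq_zero_and_coeff_eq_one x
    obtain ⟨y, hy | hy⟩ := IsLocalRing.exists_algebraMap_eq_or_eq_inv_of_aeval_eq_zero
      (A := integralClosure V L) (p := p.map (algebraMap V _)) (x := x)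
      (by rwa [aeval_map_algebraMap]) ⟨i, by simp [hi]⟩
    · exact .inl (hy ▸ y.2)
    · exact .inr (hy ▸ y.2)
  let W := ofSubring (integralClosure V L).toSubring hor
  have hW (x : L) : x ∈ W ↔ IsIntegral V x := Iff.rfl
  refine ⟨W, rfl, dominates_iff.mpr fun x hx ↦ ?_, fun W' h ↦ ?_⟩
  · rw [hW, isIntegral_algebraMap_iff_mem, mem_nonunits_iff_or, mem_nonunits_iff_or, ← map_inv₀,
      hW, isIntegral_algebraMap_iff_mem, map_eq_zero]
    exact ⟨hx, Iff.rfl⟩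
  · refine le_antisymm (fun x hx ↦ ?_) fun x hx ↦ h.mem_of_isIntegral hx
    by_contra hxW
    have hx' : x⁻¹ ∈ integralClosure V L := (hor x).resolve_left hxW
    have hx0 : x ≠ 0 := by rintro rfl; exact hxW (zero_mem W)
    have hmem : (⟨x⁻¹, hx'⟩ : integralClosure V L) ∈ maximalIdeal (integralClosure V L) := by
      rw [mem_maximalIdeal, _root_.mem_nonunits_iff]
      intro hu
      obtain ⟨y, hy⟩ := hu.exists_right_inv
      have := congr_arg (algebraMap _ L) hy
      rw [map_mul, map_one] at this
      have hyx : (y : L) = x := by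
        have := eq_inv_of_mul_eq_one_right this
        exact this.trans (inv_inv x)
      exact hxW (hyx ▸ y.2)
    have := h.coe_mem_nonunits_of_mem_maximalIdeal hmem
    rw [mem_nonunits_iff_or, inv_inv] at this
    exact this.elim (inv_ne_zero hx0) (· hx)

theorem map_algEquiv_mem_nonunits {W : ValuationSubring L}
    (hW : ∀ x, x ∈ W ↔ IsIntegral V x) (σ : L ≃ₐ[K] L) {x : L} (hx : x ∈ W.nonunits) :
    σ x ∈ W.nonunits := by
  rw [mem_nonunits_iff_or, hW] at hx ⊢
  rwa [← map_inv₀, map_eq_zero, show IsIntegral V (σ x⁻¹) ↔ IsIntegral V x⁻¹ from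
    isIntegral_algEquiv (σ.restrictScalars V)]

theorem Dominates.henselianLocalRing [IsAlgClosure K L] {W : ValuationSubring L}
    (h : W.Dominates V) (hW : ∀ x, x ∈ W ↔ IsIntegral V x) : HenselianLocalRing V := by
  have := IsAlgClosure.isAlgClosed (R := K) (K := L)
  have : Algebra.IsAlgebraic K L := IsAlgClosure.isAlgebraic
  refine ⟨fun f hf a₀ ha₀ ha₀' ↦ ?_⟩
  let φ : V →+* W :=
    ((algebraMap K L).comp (algebraMap V K)).codRestrict W fun y ↦ h.algebraMap_mem y.2
  have hφ (y : V) (hy : φ y ∈ maximalIdeal W) : y ∈ maximalIdeal V := by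
    rw [← coe_mem_nonunits_iff] at hy ⊢
    exact (h.algebraMap_mem_nonunits_iff y.2).mp hy
  have hmap : (f.map φ).map (algebraMap W L) = f.map (algebraMap V L) := by
    rw [Polynomial.map_map]; rfl
  obtain ⟨r, hr, hra⟩ : ∃ r : W, (f.map φ).eval r = 0 ∧ φ a₀ - r ∈ maximalIdeal W := by
    by_contra! hcon
    have hlt : W.valuation ((f.map (algebraMap V L)).eval (algebraMap V L a₀)) < 1 := by
      rw [← mem_nonunits_iff, eval_map, eval₂_hom]
      exact (h.algebraMap_mem_nonunits_iff (f.eval a₀).2).mpr (V.coe_mem_nonunits_iff.mpr ha₀)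
    rw [(IsAlgClosed.splits _).eval_eq_prod_roots_of_monic (hf.map _), map_multiset_prod] at hlt
    refine hlt.not_ge (Multiset.one_le_prod fun v hv ↦ ?_)
    rw [Multiset.map_map, Multiset.mem_map] at hv
    obtain ⟨r, hr, rfl⟩ := hv
    have hr0 := (mem_roots'.mp hr).2
    have hrW : r ∈ W := (hW r).mpr ⟨f, hf, by rwa [IsRoot.def, eval_map] at hr0⟩
    by_contra! hlt
    refine hcon ⟨r, hrW⟩ ?_ (W.coe_mem_nonunits_iff.mp hlt)
    apply FaithfulSMul.algebraMap_injective W L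
    rw [map_zero, ← eval_map_apply, hmap]
    exact hr0
  have hder : IsUnit ((f.map φ).derivative.eval r) := by
    have hu : IsUnit ((f.map φ).derivative.eval (φ a₀)) := by
      rw [derivative_map, eval_map_apply]
      exact ha₀'.map φ
    by_contra hr'
    have := (maximalIdeal W).mem_of_dvd (sub_dvd_eval_sub (φ a₀) r (f.map φ).derivative) hra
    exact (((maximalIdeal W).sub_mem_iff_left hr').mp this) hu
  have hderL : (f.map (algebraMap V K)).derivative.aeval (r : L) ≠ 0 := by
    rw [← eval_map_algebraMap, ← derivative_map, Polynomial.map_map]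
    change (f.map (algebraMap V L)).derivative.eval (algebraMap W L r) ≠ 0
    rw [← hmap, derivative_map, eval_map_apply]
    exact (hder.map (algebraMap W L)).ne_zero
  have hrL : aeval (r : L) (f.map (algebraMap V K)) = 0 := by
    rw [← eval_map_algebraMap, Polynomial.map_map]
    change (f.map (algebraMap V L)).eval (algebraMap W L r) = 0
    rw [← hmap, eval_map_apply, hr, map_zero]
  have hsep : IsSeparable K (r : L) := by
    refine (separable_iff_derivative_ne_zero
      (minpoly.irreducible (Algebra.IsIntegral.isIntegral (r : L)))).mpr fun h0 ↦ hderL ?_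
    obtain ⟨c, hc⟩ := minpoly.dvd K (r : L) hrL
    simp [hc, h0]
  have hconj (s : L) (hs : IsConjRoot K (r : L) s) : (r : L) = s := by
    obtain ⟨σ, rfl⟩ := isConjRoot_iff_exists_algEquiv.mp hs.symm
    have hσr : σ r ∈ W :=
      (hW _).mpr ((isIntegral_algEquiv (σ.restrictScalars V)).mpr ((hW _).mp r.2))
    have hσ0 : (f.map φ).eval (⟨σ r, hσr⟩ : W) = 0 := by
      apply FaithfulSMul.algebraMap_injective W L
      rw [map_zero, ← eval_map_apply, hmap]
      have := congr_arg σ hrL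
      rw [map_zero, ← AlgEquiv.coe_toAlgHom, ← aeval_algHom_apply, ← eval_map_algebraMap,
        Polynomial.map_map] at this
      exact this
    have hσa : φ a₀ - ⟨σ r, hσr⟩ ∈ maximalIdeal W := by
      rw [← coe_mem_nonunits_iff] at hra ⊢
      have := map_algEquiv_mem_nonunits hW σ hra
      have hc : σ (φ a₀) = φ a₀ := σ.commutes _
      simpa [hc] using this
    have hrσ : r - ⟨σ r, hσr⟩ ∈ maximalIdeal W := by
      simpa using (maximalIdeal W).sub_mem hσa hra
    exact congr_arg Subtype.val (eq_of_eval_eq_zero_of_not_isUnit_sub hr hσ0 hrσ hder)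
  obtain ⟨x, hx⟩ : (r : L) ∈ (⊥ : Subalgebra K L) := by
    by_contra hn
    obtain ⟨s, hs, hrs⟩ := (notMem_iff_exists_ne_and_isConjRoot hsep (IsAlgClosed.splits _)).mp hn
    exact hs (hconj s hrs)
  replace hx : algebraMap K L x = r := hx
  have hxV : x ∈ V := isIntegral_algebraMap_iff_mem.mp (hx ▸ (hW _).mp r.2)
  have hxr : φ ⟨x, hxV⟩ = r := Subtype.ext hx
  refine ⟨⟨x, hxV⟩, ?_, hφ _ ?_⟩
  · rw [← hxr, eval_map_apply] at hr
    exact FaithfulSMul.algebraMap_injective V L ((congr_arg Subtype.val hr).trans (map_zero _).symm)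
  · rw [map_sub, hxr, ← neg_sub]
    exact (maximalIdeal W).neg_mem hra

end ValuationSubring

end

/-- Let `V` be a valuation ring of a field `K`.  Then `V` is Henselian if
and only if for every algebraic field extension `L` of `K`, the integral closure `A` of `V` in
`L` is (the underlying set of) a valuation ring of `L`, and this valuation ring is the unique
valuation ring of `L` dominating `V`. -/
theorem henselian_iff_unique_dominating_valuationSubring
    {K : Type u} [Field K] (V : ValuationSubring K) :
    HenselianLocalRing ↥V ↔
      ∀ (L : Type u) [Field L] [Algebra K L], Algebra.IsAlgebraic K L →
        ∃ W : ValuationSubring L,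
          (↑W : Set L) =
            {x : L | ((algebraMap K L).comp (algebraMap ↥V K)).IsIntegralElem x} ∧
          W.Dominates V ∧
          ∀ W' : ValuationSubring L, W'.Dominates V → W' = W := by
  refine ⟨fun _ L _ _ _ ↦ V.exists_coe_eq_integralClosure L, fun H ↦ ?_⟩
  obtain ⟨W, hW, h, -⟩ := H (AlgebraicClosure K) inferInstance
  exact h.henselianLocalRing fun x ↦ Set.ext_iff.mp hW x
end
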